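/- Two distribution functions F₁, F₂ on (0,∞) satisfy: the convolution F₁*F₂ is subexponential if and only if P(X₁ + X₂ > x) ∼ (1-F₁(x)) + (1-F₂(x)) as x → ∞, where X₁ ~ F₁ and X₂ ~ F₂ are independent — provided F₁*F₂ ∈ S implies this tail equivalence and conversely (under the assumption that F₁ and F₂ are each in a suitable class ensuring the Embrechts–Goldie criterion applies). -/

import Mathlib

open MeasureTheory Filter ProbabilityTheory

/-- The tail `1 - F(x)` of a distribution `μ` on `ℝ`. -/
noncomputable def mtail (μ : Measure ℝ) (x : ℝ) : ℝ := (μ (Set.Ioi x)).toReal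

/-- The convolution `F₁ * F₂`: the law of `X₁ + X₂` for independent `X₁ ~ F₁`, `X₂ ~ F₂`. -/
noncomputable def mconv (μ ν : Measure ℝ) : Measure ℝ :=
  (μ.prod ν).map (fun p => p.1 + p.2)

/-- `μ` is subexponential: supported in `(0,∞)`, positive tail, and
`(1 - F^{*2}(x))/(1 - F(x)) → 2`. -/
def Subexp (μ : Measure ℝ) : Prop :=
  μ (Set.Iic 0) = 0 ∧ (∀ x, 0 < mtail μ x) ∧
  Tendsto (fun x => mtail (mconv μ μ) x / mtail μ x) atTop (nhds 2)

open Asymptotics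

/-- The probability that independent `X ~ μ` and `Y ~ ν` both exceed `A` while `X + Y > x`. -/
noncomputable def jointTail (μ ν : Measure ℝ) (A x : ℝ) : ℝ :=
  (μ.prod ν).real {p | A < p.1 ∧ A < p.2 ∧ x < p.1 + p.2}

/-- The tail of `μ` is insensitive to bounded shifts. -/
def LongTailed (μ : Measure ℝ) : Prop :=
  ∀ A, 0 ≤ A → (fun x => mtail μ (x - A)) ~[atTop] mtail μ

section Basic

variable {μ ν ρ : Measure ℝ}

lemma mconv_eq_conv (μ ν : Measure ℝ) : mconv μ ν = μ.conv ν := rfl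

instance [IsProbabilityMeasure μ] [IsProbabilityMeasure ν] :
    IsProbabilityMeasure (mconv μ ν) := by
  rw [mconv_eq_conv]; infer_instance

lemma mtail_nonneg (μ : Measure ℝ) (x : ℝ) : 0 ≤ mtail μ x := ENNReal.toReal_nonneg

lemma mtail_le_one [IsProbabilityMeasure μ] (x : ℝ) : mtail μ x ≤ 1 :=
  measureReal_le_one

lemma mtail_antitone [IsProbabilityMeasure μ] : Antitone (mtail μ) := fun _ _ h =>
  measureReal_mono (μ := μ) (Set.Ioi_subset_Ioi h)

lemma tendsto_mtail_atTop [IsProbabilityMeasure μ] : Tendsto (mtail μ) atTop (nhds 0) := by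
  have h : mtail μ = fun x => 1 - cdf μ x := by
    funext x
    rw [cdf_eq_real, ← probReal_compl_eq_one_sub measurableSet_Iic, Set.compl_Iic]
    rfl
  rw [h]
  simpa using (tendsto_cdf_atTop μ).const_sub 1

lemma mtail_zero [IsProbabilityMeasure μ] (h : μ (Set.Iic 0) = 0) : mtail μ 0 = 1 := by
  change μ.real _ = 1
  rw [← Set.compl_Iic, probReal_compl_eq_one_sub measurableSet_Iic]
  simp [measureReal_def, h]

lemma real_Ioc_eq_mtail_sub [IsProbabilityMeasure μ] {a b : ℝ} (hab : a ≤ b) :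
    μ.real (Set.Ioc a b) = mtail μ a - mtail μ b := by
  rw [← Set.Ioi_sdiff_Ioi, measureReal_sdiff (Set.Ioi_subset_Ioi hab) measurableSet_Ioi]
  rfl

lemma mtail_mconv [IsProbabilityMeasure μ] [IsProbabilityMeasure ν] (x : ℝ) :
    mtail (mconv μ ν) x = (μ.prod ν).real {p | x < p.1 + p.2} :=
  map_measureReal_apply (by fun_prop) measurableSet_Ioi

lemma mconv_Iic_zero [IsProbabilityMeasure μ] [IsProbabilityMeasure ν]
    (hμ : μ (Set.Iic 0) = 0) (hν : ν (Set.Iic 0) = 0) : mconv μ ν (Set.Iic 0) = 0 := by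
  rw [mconv, Measure.map_apply (by fun_prop) measurableSet_Iic]
  refine measure_mono_null (t := Set.Iic 0 ×ˢ Set.univ ∪ Set.univ ×ˢ Set.Iic 0) ?_ ?_
  · intro p hp
    simp only [Set.mem_preimage, Set.mem_Iic, Set.mem_union, Set.mem_prod, Set.mem_univ,
      and_true, true_and] at hp ⊢
    by_contra! h
    linarith
  · rw [measure_union_null_iff, Measure.prod_prod, Measure.prod_prod]
    simp [hμ, hν]

lemma measurableSet_jointTail (A x : ℝ) :
    MeasurableSet {p : ℝ × ℝ | A < p.1 ∧ A < p.2 ∧ x < p.1 + p.2} := by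
  exact (measurableSet_lt measurable_const measurable_fst).inter
    ((measurableSet_lt measurable_const measurable_snd).inter
      (measurableSet_lt measurable_const (measurable_fst.add measurable_snd)))

lemma jointTail_comm [IsProbabilityMeasure μ] [IsProbabilityMeasure ν] (A x : ℝ) :
    jointTail μ ν A x = jointTail ν μ A x := by
  rw [jointTail, ← Measure.prod_swap,
    map_measureReal_apply measurable_swap (measurableSet_jointTail A x), jointTail]
  congr 1
  ext p
  simp only [Set.mem_preimage, Set.mem_ofPred_eq, Prod.fst_swap, Prod.snd_swap, add_comm p.2 p.1]
  tauto

/-- Replacing one factor by a measure with a dominating tail enlarges `jointTail`. -/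
lemma jointTail_le_mul [IsProbabilityMeasure μ] [IsProbabilityMeasure ν] [IsProbabilityMeasure ρ]
    {C A : ℝ} (hC : 0 ≤ C) (h : ∀ t, A ≤ t → mtail μ t ≤ C * mtail ρ t) (x : ℝ) :
    jointTail μ ν A x ≤ C * jointTail ρ ν A x := by
  have key : (μ.prod ν) {p | A < p.1 ∧ A < p.2 ∧ x < p.1 + p.2} ≤
      ENNReal.ofReal C * (ρ.prod ν) {p | A < p.1 ∧ A < p.2 ∧ x < p.1 + p.2} := by
    rw [Measure.prod_apply_symm (measurableSet_jointTail A x),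
      Measure.prod_apply_symm (measurableSet_jointTail A x),
      ← lintegral_const_mul' _ _ ENNReal.ofReal_ne_top]
    refine lintegral_mono fun y => ?_
    by_cases hy : A < y
    · have hs : (fun z => (z, y)) ⁻¹' {p : ℝ × ℝ | A < p.1 ∧ A < p.2 ∧ x < p.1 + p.2} =
          Set.Ioi (max A (x - y)) := by
        ext z
        simp [hy, sub_lt_iff_lt_add]
      simp only [hs]
      rw [← ofReal_measureReal, ← ofReal_measureReal (μ := ρ), ← ENNReal.ofReal_mul hC]
      exact ENNReal.ofReal_le_ofReal (h _ (le_max_left _ _))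
    · simp [hy]
  have := ENNReal.toReal_mono
    (ENNReal.mul_ne_top ENNReal.ofReal_ne_top (measure_ne_top _ _)) key
  rwa [ENNReal.toReal_mul, ENNReal.toReal_ofReal hC] at this

lemma LongTailed.of_isEquivalent_const_mul {c : ℝ} (h : LongTailed μ)
    (hν : mtail ν ~[atTop] fun x => c * mtail μ x) : LongTailed ν := by
  intro A hA
  have h1 := hν.comp_tendsto (tendsto_atTop_add_const_right atTop (-A) tendsto_id)
  have h2 : (fun x => c * mtail μ (x - A)) ~[atTop] fun x => c * mtail μ x :=
    IsEquivalent.refl.mul (h A hA)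
  exact (h1.trans h2).trans hν.symm

lemma Subexp.tendsto_div_two_mul (h : Subexp μ) :
    Tendsto (fun x => mtail (mconv μ μ) x / (mtail μ x + mtail μ x)) atTop (nhds 1) := by
  have := h.2.2.div_const 2
  rw [div_self two_ne_zero] at this
  refine this.congr fun x => ?_
  rw [div_div, mul_two]

lemma Subexp.isEquivalent_mconv_self (h : Subexp μ) :
    mtail (mconv μ μ) ~[atTop] fun x => 2 * mtail μ x := by
  rw [isEquivalent_iff_tendsto_one
    (Eventually.of_forall fun x => (mul_pos two_pos (h.2.1 x)).ne')]
  refine h.tendsto_div_two_mul.congr fun x => ?_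
  rw [← two_mul]
  rfl

end Basic

section Bounds

variable {μ ν : Measure ℝ} [IsProbabilityMeasure μ] [IsProbabilityMeasure ν]

lemma mtail_mconv_le (A x : ℝ) :
    mtail (mconv μ ν) x ≤ mtail μ (x - A) + mtail ν (x - A) + jointTail μ ν A x := by
  have hsub : {p : ℝ × ℝ | x < p.1 + p.2} ⊆
      (Set.Ioi (x - A) ×ˢ Set.univ ∪ Set.univ ×ˢ Set.Ioi (x - A)) ∪
        {p | A < p.1 ∧ A < p.2 ∧ x < p.1 + p.2} := by
    intro p hp
    simp only [Set.mem_union, Set.mem_prod, Set.mem_Ioi, Set.mem_univ, and_true, true_and,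
      Set.mem_ofPred_eq] at hp ⊢
    by_contra! h
    rcases le_or_gt p.1 A with h1 | h1
    · linarith [h.1.2]
    · rcases le_or_gt p.2 A with h2 | h2
      · linarith [h.1.1]
      · linarith [h.2 h1 h2]
  have h := (measureReal_mono (μ := μ.prod ν) hsub).trans
    ((measureReal_union_le _ _).trans (add_le_add_left (measureReal_union_le _ _) _))
  rw [measureReal_prod_prod, measureReal_prod_prod, probReal_univ, probReal_univ, mul_one,
    one_mul] at h
  rw [mtail_mconv]
  exact h

/-- `P(X + Y > x) ≥ P(max X Y > x)`. -/
lemma le_mtail_mconv (hμ : μ (Set.Iic 0) = 0) (hν : ν (Set.Iic 0) = 0) {x : ℝ} (hx : 0 ≤ x) :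
    mtail μ x + (1 - mtail μ x) * mtail ν x ≤ mtail (mconv μ ν) x := by
  have hsub : Set.Ioi x ×ˢ Set.Ioi 0 ∪ Set.Ioc 0 x ×ˢ Set.Ioi x ⊆
      {p : ℝ × ℝ | x < p.1 + p.2} := by
    rintro p (⟨h1, h2⟩ | ⟨⟨h1, -⟩, h2⟩) <;> simp only [Set.mem_Ioi, Set.mem_ofPred_eq] at * <;>
      linarith
  have hd : Disjoint (Set.Ioi x ×ˢ Set.Ioi (0 : ℝ)) (Set.Ioc 0 x ×ˢ Set.Ioi x) := by
    rw [Set.disjoint_left]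
    rintro p ⟨h1, -⟩ ⟨⟨-, h2⟩, -⟩
    exact absurd h1 (not_lt.2 h2)
  have h := measureReal_mono (μ := μ.prod ν) hsub
  rw [measureReal_union hd (measurableSet_Ioc.prod measurableSet_Ioi), measureReal_prod_prod,
    measureReal_prod_prod, real_Ioc_eq_mtail_sub hx, mtail_zero hμ] at h
  rw [mtail_mconv]
  have h0 : ν.real (Set.Ioi 0) = 1 := mtail_zero hν
  rw [h0, mul_one] at h
  exact h

lemma mtail_left_le_mtail_mconv (hμ : μ (Set.Iic 0) = 0) (hν : ν (Set.Iic 0) = 0)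
    {x : ℝ} (hx : 0 ≤ x) : mtail μ x ≤ mtail (mconv μ ν) x := by
  nlinarith [le_mtail_mconv hμ hν hx, mtail_nonneg ν x, mtail_le_one (μ := μ) x]

lemma mconv_comm (μ ν : Measure ℝ) [IsProbabilityMeasure μ] [IsProbabilityMeasure ν] :
    mconv μ ν = mconv ν μ := Measure.conv_comm μ ν

lemma mtail_right_le_mtail_mconv (hμ : μ (Set.Iic 0) = 0) (hν : ν (Set.Iic 0) = 0)
    {x : ℝ} (hx : 0 ≤ x) : mtail ν x ≤ mtail (mconv μ ν) x := by
  rw [mconv_comm]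
  exact mtail_left_le_mtail_mconv hν hμ hx

lemma mtail_mconv_pos (hμ : μ (Set.Iic 0) = 0) (hν : ν (Set.Iic 0) = 0)
    (h : ∀ x, 0 < mtail μ x) (x : ℝ) : 0 < mtail (mconv μ ν) x :=
  (h _).trans_le ((mtail_left_le_mtail_mconv hμ hν (le_max_right x 0)).trans
    (mtail_antitone (le_max_left x 0)))

lemma add_jointTail_le_mtail_mconv (hμ : μ (Set.Iic 0) = 0) (hν : ν (Set.Iic 0) = 0)
    {A x : ℝ} (hA : 0 ≤ A) (hx : A ≤ x) :
    (1 - mtail μ A) * mtail ν x + mtail μ x * (1 - mtail ν A) + jointTail μ ν A x ≤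
      mtail (mconv μ ν) x := by
  have hsub : (Set.Ioc 0 A ×ˢ Set.Ioi x ∪ Set.Ioi x ×ˢ Set.Ioc 0 A) ∪
      {p | A < p.1 ∧ A < p.2 ∧ x < p.1 + p.2} ⊆ {p : ℝ × ℝ | x < p.1 + p.2} := by
    rintro p ((⟨⟨h1, -⟩, h2⟩ | ⟨h1, ⟨h2, -⟩⟩) | ⟨-, -, h⟩) <;>
      simp only [Set.mem_Ioi, Set.mem_ofPred_eq] at * <;> linarith
  have hd1 : Disjoint (Set.Ioc 0 A ×ˢ Set.Ioi x) (Set.Ioi x ×ˢ Set.Ioc 0 A) := by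
    rw [Set.disjoint_left]
    rintro p ⟨⟨-, h1⟩, -⟩ ⟨h2, -⟩
    exact absurd h2 (not_lt.2 (h1.trans hx))
  have hd2 : Disjoint (Set.Ioc 0 A ×ˢ Set.Ioi x ∪ Set.Ioi x ×ˢ Set.Ioc 0 A)
      {p : ℝ × ℝ | A < p.1 ∧ A < p.2 ∧ x < p.1 + p.2} := by
    rw [Set.disjoint_left]
    rintro p (⟨⟨-, h1⟩, -⟩ | ⟨-, ⟨-, h1⟩⟩) ⟨h2, h3, -⟩ <;> linarith
  have h := measureReal_mono (μ := μ.prod ν) hsub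
  rw [measureReal_union hd2 (measurableSet_jointTail A x),
    measureReal_union hd1 (measurableSet_Ioi.prod measurableSet_Ioc), measureReal_prod_prod,
    measureReal_prod_prod, real_Ioc_eq_mtail_sub hA, real_Ioc_eq_mtail_sub hA, mtail_zero hμ,
    mtail_zero hν] at h
  rw [mtail_mconv]
  exact h

lemma le_mtail_mconv_self (hμ : μ (Set.Iic 0) = 0) {y x : ℝ} (hy : 0 ≤ y) (hx : y ≤ x) :
    mtail μ x + (1 - mtail μ y) * mtail μ x + (mtail μ y - mtail μ x) * mtail μ (x - y) ≤
      mtail (mconv μ μ) x := by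
  have hsub : (Set.Ioi x ×ˢ Set.Ioi 0 ∪ Set.Ioc 0 y ×ˢ Set.Ioi x) ∪
      Set.Ioc y x ×ˢ Set.Ioi (x - y) ⊆ {p : ℝ × ℝ | x < p.1 + p.2} := by
    rintro p ((⟨h1, h2⟩ | ⟨⟨h1, -⟩, h2⟩) | ⟨⟨h1, -⟩, h2⟩) <;>
      simp only [Set.mem_Ioi, Set.mem_ofPred_eq] at * <;> linarith
  have hd1 : Disjoint (Set.Ioi x ×ˢ Set.Ioi (0 : ℝ)) (Set.Ioc 0 y ×ˢ Set.Ioi x) := by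
    rw [Set.disjoint_left]
    rintro p ⟨h1, -⟩ ⟨⟨-, h2⟩, -⟩
    exact absurd h1 (not_lt.2 (h2.trans hx))
  have hd2 : Disjoint (Set.Ioi x ×ˢ Set.Ioi (0 : ℝ) ∪ Set.Ioc 0 y ×ˢ Set.Ioi x)
      (Set.Ioc y x ×ˢ Set.Ioi (x - y)) := by
    rw [Set.disjoint_left]
    rintro p (⟨h1, -⟩ | ⟨⟨-, h1⟩, -⟩) ⟨⟨h2, h3⟩, -⟩
    · exact absurd h1 (not_lt.2 h3)
    · linarith
  have h := measureReal_mono (μ := μ.prod μ) hsub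
  rw [measureReal_union hd2 (measurableSet_Ioc.prod measurableSet_Ioi),
    measureReal_union hd1 (measurableSet_Ioc.prod measurableSet_Ioi), measureReal_prod_prod,
    measureReal_prod_prod, measureReal_prod_prod, real_Ioc_eq_mtail_sub hy,
    real_Ioc_eq_mtail_sub hx, mtail_zero hμ] at h
  rw [mtail_mconv]
  have h0 : μ.real (Set.Ioi 0) = 1 := mtail_zero hμ
  rw [h0, mul_one] at h
  exact h

end Bounds

section Asymptotic

variable {μ ν : Measure ℝ} [IsProbabilityMeasure μ] [IsProbabilityMeasure ν]

lemma Subexp.longTailed (h : Subexp μ) : LongTailed μ := by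
  obtain ⟨h0, hpos, hlim⟩ := h
  intro y hy
  rw [isEquivalent_iff_tendsto_one (Eventually.of_forall fun x => (hpos x).ne')]
  have hub : Tendsto (fun x => (mtail (mconv μ μ) x / mtail μ x - 2 + mtail μ y) /
      (mtail μ y - mtail μ x)) atTop (nhds 1) := by
    have := ((hlim.sub_const 2).add_const (mtail μ y)).div
      ((tendsto_mtail_atTop (μ := μ)).const_sub (mtail μ y)) (by simpa using (hpos y).ne')
    rwa [sub_self, zero_add, sub_zero, div_self (hpos y).ne'] at this
  refine tendsto_of_tendsto_of_tendsto_of_le_of_le' tendsto_const_nhds hub ?_ ?_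
  · refine Eventually.of_forall fun x => ?_
    simp only [Pi.div_apply]
    rw [le_div_iff₀ (hpos x), one_mul]
    exact mtail_antitone (by linarith)
  · filter_upwards [eventually_ge_atTop y,
      (tendsto_mtail_atTop (μ := μ)).eventually_lt_const (hpos y)] with x hx hlt
    simp only [Pi.div_apply]
    have hp := hpos x
    rw [le_div_iff₀ (sub_pos.2 hlt), div_mul_eq_mul_div, div_le_iff₀ hp, add_mul, sub_mul,
      div_mul_cancel₀ _ hp.ne']
    linarith [le_mtail_mconv_self h0 hy hx]

lemma exists_jointTail_le (hμ : μ (Set.Iic 0) = 0) (hν : ν (Set.Iic 0) = 0)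
    (hpos : ∀ x, 0 < mtail μ x)
    (h : Tendsto (fun x => mtail (mconv μ ν) x / (mtail μ x + mtail ν x)) atTop (nhds 1))
    {ε : ℝ} (hε : 0 < ε) :
    ∃ A, 0 ≤ A ∧ ∀ᶠ x in atTop, jointTail μ ν A x ≤ ε * (mtail μ x + mtail ν x) := by
  obtain ⟨A, hA, hμA, hνA⟩ := ((eventually_ge_atTop (0 : ℝ)).and
    (((tendsto_mtail_atTop (μ := μ)).eventually_le_const (half_pos hε)).and
      ((tendsto_mtail_atTop (μ := ν)).eventually_le_const (half_pos hε)))).exists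
  refine ⟨A, hA, ?_⟩
  filter_upwards [eventually_ge_atTop A,
    h.eventually_le_const (show (1 : ℝ) < 1 + ε / 2 by linarith)] with x hx hr
  rw [div_le_iff₀ (add_pos_of_pos_of_nonneg (hpos x) (mtail_nonneg ν x))] at hr
  nlinarith [add_jointTail_le_mtail_mconv hμ hν hA hx, mtail_nonneg ν x, mtail_nonneg μ x]

lemma tendsto_mtail_mconv_div (hμ : μ (Set.Iic 0) = 0) (hν : ν (Set.Iic 0) = 0)
    (hpos : ∀ x, 0 < mtail μ x) (hpos' : ∀ x, 0 < mtail ν x)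
    (hLμ : LongTailed μ) (hLν : LongTailed ν)
    (h : ∀ ε > 0, ∃ A, 0 ≤ A ∧
      ∀ᶠ x in atTop, jointTail μ ν A x ≤ ε * mtail (mconv μ ν) x) :
    Tendsto (fun x => mtail (mconv μ ν) x / (mtail μ x + mtail ν x)) atTop (nhds 1) := by
  have shift {ρ : Measure ℝ} (hρ : ∀ x, 0 < mtail ρ x) (hL : LongTailed ρ) {A ε : ℝ}
      (hA : 0 ≤ A) (hε : 0 < ε) :
      ∀ᶠ x in atTop, mtail ρ (x - A) ≤ (1 + ε) * mtail ρ x := by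
    have h1 := (isEquivalent_iff_tendsto_one (Eventually.of_forall fun x => (hρ x).ne')).1 (hL A hA)
    filter_upwards [h1.eventually_le_const (show (1 : ℝ) < 1 + ε by linarith)] with x hx
    exact (div_le_iff₀ (hρ x)).1 hx
  refine tendsto_order.2 ⟨fun a ha => ?_, fun a ha => ?_⟩
  · filter_upwards [eventually_ge_atTop 0,
      (tendsto_mtail_atTop (μ := μ)).eventually_lt_const (sub_pos.2 ha)] with x hx hlt
    rw [lt_div_iff₀ (add_pos (hpos x) (hpos' x))]
    nlinarith [le_mtail_mconv hμ hν hx, hpos x, hpos' x]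
  · obtain ⟨ε, hε, hε1, hεa⟩ : ∃ ε : ℝ, 0 < ε ∧ ε < 1 ∧ 1 + ε < a * (1 - ε) := by
      refine ⟨(a - 1) / (2 * (a + 1)), by apply div_pos <;> linarith, ?_, ?_⟩
      · rw [div_lt_one (by linarith)]; linarith
      · have : (a - 1) / (2 * (a + 1)) * (2 * (a + 1)) = a - 1 :=
          div_mul_cancel₀ _ (by linarith)
        linarith
    obtain ⟨A, hA, hJ⟩ := h ε hε
    filter_upwards [hJ, shift hpos hLμ hA hε, shift hpos' hLν hA hε] with x hJ h1 h2
    have hs := add_pos (hpos x) (hpos' x)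
    rw [div_lt_iff₀ hs]
    have hb := mtail_mconv_le (μ := μ) (ν := ν) A x
    have h3 : (1 - ε) * mtail (mconv μ ν) x < (1 - ε) * (a * (mtail μ x + mtail ν x)) := by
      nlinarith
    exact lt_of_mul_lt_mul_left h3 (by linarith)

lemma mtail_add_le_two_mul (hμ : μ (Set.Iic 0) = 0) (hν : ν (Set.Iic 0) = 0)
    {x : ℝ} (hx : 0 ≤ x) : mtail μ x + mtail ν x ≤ 2 * mtail (mconv μ ν) x := by
  linarith [mtail_left_le_mtail_mconv hμ hν hx, mtail_right_le_mtail_mconv hμ hν hx]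

lemma Subexp.exists_mtail_mconv_self_le (h : Subexp μ) :
    ∃ C, 0 < C ∧ ∀ x, mtail (mconv μ μ) x ≤ C * mtail μ x := by
  obtain ⟨T, hT⟩ := eventually_atTop.1 (h.2.2.eventually_le_const (show (2 : ℝ) < 3 by norm_num))
  have hp := h.2.1
  refine ⟨3 + 1 / mtail μ T, by have := hp T; positivity, fun x => ?_⟩
  rw [add_mul]
  rcases le_total T x with hx | hx
  · have h1 := (div_le_iff₀ (hp x)).1 (hT x hx)
    have h2 : 0 ≤ 1 / mtail μ T * mtail μ x := by have := hp T; have := hp x; positivity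
    linarith
  · have h2 : 1 ≤ 1 / mtail μ T * mtail μ x := by
      rw [one_div_mul_eq_div, one_le_div (hp T)]
      exact mtail_antitone hx
    linarith [mtail_le_one (μ := mconv μ μ) x, hp x]

lemma Subexp.tendsto_of_mconv (h₁ : Subexp μ) (h₂ : Subexp ν) (h : Subexp (mconv μ ν)) :
    Tendsto (fun x => mtail (mconv μ ν) x / (mtail μ x + mtail ν x)) atTop (nhds 1) := by
  refine tendsto_mtail_mconv_div h₁.1 h₂.1 h₁.2.1 h₂.2.1 h₁.longTailed h₂.longTailed
    fun ε hε => ?_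
  obtain ⟨A, hA, hJ⟩ := exists_jointTail_le h.1 h.1 h.2.1 h.tendsto_div_two_mul (half_pos hε)
  refine ⟨A, hA, ?_⟩
  filter_upwards [hJ] with x hJ
  have hl : jointTail μ ν A x ≤ 1 * jointTail (mconv μ ν) ν A x :=
    jointTail_le_mul zero_le_one (fun t ht => by
      rw [one_mul]; exact mtail_left_le_mtail_mconv h₁.1 h₂.1 (hA.trans ht)) x
  have hr : jointTail ν (mconv μ ν) A x ≤ 1 * jointTail (mconv μ ν) (mconv μ ν) A x :=
    jointTail_le_mul zero_le_one (fun t ht => by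
      rw [one_mul]; exact mtail_right_le_mtail_mconv h₁.1 h₂.1 (hA.trans ht)) x
  rw [jointTail_comm] at hr
  linarith

lemma mconv_mconv_mconv_comm (μ ν : Measure ℝ) [IsProbabilityMeasure μ] [IsProbabilityMeasure ν] :
    mconv (mconv μ μ) (mconv ν ν) = mconv (mconv μ ν) (mconv μ ν) := by
  simp only [mconv_eq_conv]
  rw [Measure.conv_assoc, ← Measure.conv_assoc μ ν ν, Measure.conv_comm (μ.conv ν) ν,
    ← Measure.conv_assoc]

lemma Subexp.mconv_of_tendsto (h₁ : Subexp μ) (h₂ : Subexp ν)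
    (h : Tendsto (fun x => mtail (mconv μ ν) x / (mtail μ x + mtail ν x)) atTop (nhds 1)) :
    Subexp (mconv μ ν) := by
  refine ⟨mconv_Iic_zero h₁.1 h₂.1, mtail_mconv_pos h₁.1 h₂.1 h₁.2.1, ?_⟩
  have hU := mconv_Iic_zero h₁.1 h₁.1
  have hV := mconv_Iic_zero h₂.1 h₂.1
  have hUp := mtail_mconv_pos h₁.1 h₁.1 h₁.2.1
  have hVp := mtail_mconv_pos h₂.1 h₂.1 h₂.2.1
  have hUV : Tendsto (fun x => mtail (mconv (mconv μ μ) (mconv ν ν)) x /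
      (mtail (mconv μ μ) x + mtail (mconv ν ν) x)) atTop (nhds 1) := by
    refine tendsto_mtail_mconv_div hU hV hUp hVp
      (h₁.longTailed.of_isEquivalent_const_mul h₁.isEquivalent_mconv_self)
      (h₂.longTailed.of_isEquivalent_const_mul h₂.isEquivalent_mconv_self) fun ε hε => ?_
    obtain ⟨C, hC, hCμ⟩ := h₁.exists_mtail_mconv_self_le
    obtain ⟨D, hD, hDν⟩ := h₂.exists_mtail_mconv_self_le
    obtain ⟨A, hA, hJ⟩ := exists_jointTail_le h₁.1 h₂.1 h₁.2.1 h
      (show 0 < ε / (2 * (C * D)) by positivity)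
    refine ⟨A, hA, ?_⟩
    filter_upwards [hJ, eventually_ge_atTop 0] with x hJ hx
    calc jointTail (mconv μ μ) (mconv ν ν) A x
        ≤ C * jointTail μ (mconv ν ν) A x := jointTail_le_mul hC.le (fun t _ => hCμ t) x
      _ = C * jointTail (mconv ν ν) μ A x := by rw [jointTail_comm]
      _ ≤ C * (D * jointTail ν μ A x) := by
        gcongr
        exact jointTail_le_mul hD.le (fun t _ => hDν t) x
      _ = C * (D * jointTail μ ν A x) := by rw [jointTail_comm]
      _ ≤ C * (D * (ε / (2 * (C * D)) * (mtail μ x + mtail ν x))) := by gcongr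
      _ = ε / 2 * (mtail μ x + mtail ν x) := by field_simp
      _ ≤ ε / 2 * (mtail (mconv μ μ) x + mtail (mconv ν ν) x) := by
        gcongr
        · exact mtail_left_le_mtail_mconv h₁.1 h₁.1 hx
        · exact mtail_left_le_mtail_mconv h₂.1 h₂.1 hx
      _ ≤ ε / 2 * (2 * mtail (mconv (mconv μ μ) (mconv ν ν)) x) := by
        gcongr
        exact mtail_add_le_two_mul hU hV hx
      _ = ε * mtail (mconv (mconv μ μ) (mconv ν ν)) x := by ring
  rw [mconv_mconv_mconv_comm] at hUV
  have hsum : Tendsto (fun x => (mtail (mconv μ μ) x + mtail (mconv ν ν) x) /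
      (mtail μ x + mtail ν x)) atTop (nhds 2) := by
    refine tendsto_order.2 ⟨fun a ha => ?_, fun a ha => ?_⟩
    · filter_upwards [h₁.2.2.eventually_const_lt ha, h₂.2.2.eventually_const_lt ha] with x hx hy
      rw [lt_div_iff₀ (h₁.2.1 x)] at hx
      rw [lt_div_iff₀ (h₂.2.1 x)] at hy
      rw [lt_div_iff₀ (add_pos (h₁.2.1 x) (h₂.2.1 x))]
      linarith
    · filter_upwards [h₁.2.2.eventually_lt_const ha, h₂.2.2.eventually_lt_const ha] with x hx hy
      rw [div_lt_iff₀ (h₁.2.1 x)] at hx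
      rw [div_lt_iff₀ (h₂.2.1 x)] at hy
      rw [div_lt_iff₀ (add_pos (h₁.2.1 x) (h₂.2.1 x))]
      linarith
  have hlim := (hUV.mul hsum).div h one_ne_zero
  rw [one_mul, div_one] at hlim
  refine hlim.congr fun x => ?_
  have := hUp x
  have := hVp x
  have := h₁.2.1 x
  have := h₂.2.1 x
  have := mtail_mconv_pos h₁.1 h₂.1 h₁.2.1 x
  simp only [Pi.div_apply]
  field_simp

end Asymptotic

/-- Embrechts–Goldie criterion: for subexponential distributions `F₁`, `F₂` on `(0,∞)`,
the convolution `F₁*F₂` is subexponential if and only if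
`P(X₁ + X₂ > x) ∼ (1-F₁(x)) + (1-F₂(x))` as `x → ∞`. -/
theorem embrechts_goldie (μ₁ μ₂ : Measure ℝ)
    [IsProbabilityMeasure μ₁] [IsProbabilityMeasure μ₂]
    (h₁ : Subexp μ₁) (h₂ : Subexp μ₂) :
    Subexp (mconv μ₁ μ₂) ↔
      Tendsto (fun x => mtail (mconv μ₁ μ₂) x / (mtail μ₁ x + mtail μ₂ x))
        atTop (nhds 1) := by
  exact ⟨h₁.tendsto_of_mconv h₂, h₁.mconv_of_tendsto h₂⟩
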